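/- If |A ∩ {n−k, n−k+1, …, n−1}| is even, then S_1 = ⋃_{j ∈ V_0} C_j and |S_1| = n·(((1+√5)/2)^{w−1} − ((1−√5)/2)^{w−1})/√5 = n·Fib(w−1); otherwise S_1 = ⋃_{j ∈ V_1} C_j and |S_1| = n·(((1+√5)/2)^{n−w−1} − ((1−√5)/2)^{n−w−1})/√5 = n·Fib(n−w−1), where Fib is the Fibonacci sequence with Fib(1)=Fib(2)=1. -/

import Mathlib

/-- The `i`-th ternary digit (indices read modulo `n`) of the residue of `j` modulo `3^n - 1`. -/
def dig (n : ℕ) (j : ℤ) (i : ℕ) : ℕ :=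
  ((j % ((3 : ℤ) ^ n - 1)).toNat / 3 ^ (i % n)) % 3

/-- The ternary weight of (the residue modulo `3^n - 1` of) `j`. -/
def wt (n : ℕ) (j : ℤ) : ℕ := ∑ i ∈ Finset.range n, dig n j i

/-- `d = (3^k + 1)/2`. -/
def cmD (k : ℕ) : ℤ := ((3 : ℤ) ^ k + 1) / 2

/-- The set `S_1`. -/
def S1 (n k : ℕ) : Set ℤ :=
  {j | 0 < j ∧ j < 3 ^ n - 1 ∧
    wt n j + wt n (3 ^ k * j) = wt n ((3 ^ k + 1) * j) + 2 ∧
    2 * wt n (-(j * cmD k)) = wt n (-((3 ^ k + 1) * j))}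
/-- The set `A = { ik mod n : 0 ≤ i ≤ w-1 }`. -/
def Aset (n k w : ℕ) : Finset ℕ := (Finset.range w).image (fun i => i * k % n)

/-- The cyclotomic coset of `j` modulo `3^n - 1`. -/
def Ccoset (n : ℕ) (j : ℤ) : Set ℤ :=
  {m | ∃ t : ℕ, t < n ∧ m = (3 ^ t * j) % ((3 : ℤ) ^ n - 1)}

/-- The set `V_0`. -/
def V0set (n k w : ℕ) : Set ℤ :=
  {j | 0 < j ∧ j < 3 ^ n - 1 ∧
    (∀ i, w ≤ i → i ≤ n - 1 → dig n j (i * k) = 1) ∧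
    dig n j 0 = 2 ∧ dig n j k = 0 ∧ dig n j ((w - 1) * k) = 0 ∧
    (∀ i, 2 ≤ i → i ≤ w - 2 → dig n j (i * k) = 0 ∨ dig n j (i * k) = 2) ∧
    (∀ i, 2 ≤ i → i + 1 ≤ w - 2 → ¬(dig n j (i * k) = 2 ∧ dig n j ((i + 1) * k) = 2))}

/-- The set `V_1`. -/
def V1set (n k w : ℕ) : Set ℤ :=
  {j | 0 < j ∧ j < 3 ^ n - 1 ∧
    (∀ i, i ≤ w - 1 → dig n j (i * k) = 1) ∧
    dig n j (w * k) = 0 ∧ dig n j ((n - 2) * k) = 0 ∧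
    (∀ i, w + 1 ≤ i → i ≤ n - 3 → dig n j (i * k) = 0 ∨ dig n j (i * k) = 2) ∧
    dig n j ((n - 1) * k) = 2 ∧
    (∀ i, w + 1 ≤ i → i + 1 ≤ n - 3 → ¬(dig n j (i * k) = 2 ∧ dig n j ((i + 1) * k) = 2))}

/-- The residue of `3 ^ (-i) * x` modulo `3 ^ n - 1`. -/
def rot (n : ℕ) (x : ℤ) (i : ZMod n) : ℤ := 3 ^ (-i).val * x % (3 ^ n - 1)

/-- The ternary digit of `x` at the cyclic position `i`. -/
def tdig (n : ℕ) (x : ℤ) (i : ZMod n) : ℤ := rot n x i % 3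

/-- The carry into position `i` when adding `x` and `y` modulo `3 ^ n - 1`. -/
def carry (n : ℕ) (x y : ℤ) (i : ZMod n) : ℤ :=
  (rot n x i + rot n y i - rot n (x + y) i) / (3 ^ n - 1)

lemma modulus_pos {n : ℕ} (hn : 2 ≤ n) : (0 : ℤ) < 3 ^ n - 1 := by
  have : (3 : ℤ) ^ 2 ≤ 3 ^ n := pow_le_pow_right₀ (by norm_num) hn
  linarith

lemma pow_emod_modulus (n : ℕ) (t : ℕ) : (3 : ℤ) ^ t ≡ 3 ^ (t % n) [ZMOD 3 ^ n - 1] := by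
  conv_lhs => rw [← Nat.mod_add_div t n, pow_add, pow_mul]
  have h : (3 : ℤ) ^ n ≡ 1 [ZMOD 3 ^ n - 1] := by
    rw [Int.modEq_iff_dvd]; exact ⟨-1, by ring⟩
  simpa using (h.pow (t / n)).mul_left (3 ^ (t % n))

lemma pow_modEq_of_cast_eq {n a b : ℕ} (h : (a : ZMod n) = b) :
    (3 : ℤ) ^ a ≡ 3 ^ b [ZMOD 3 ^ n - 1] := by
  have h' : a % n = b % n := (ZMod.natCast_eq_natCast_iff' a b n).1 h
  exact (pow_emod_modulus n a).trans (h' ▸ (pow_emod_modulus n b).symm)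

section

variable {n : ℕ}

lemma rot_congr {x y : ℤ} (h : x ≡ y [ZMOD 3 ^ n - 1]) (i : ZMod n) : rot n x i = rot n y i :=
  h.mul_left _

lemma rot_zero (x : ℤ) : rot n x 0 = x % (3 ^ n - 1) := by simp [rot]

lemma tdig_congr {x y : ℤ} (h : x ≡ y [ZMOD 3 ^ n - 1]) (i : ZMod n) : tdig n x i = tdig n y i := by
  rw [tdig, tdig, rot_congr h]

lemma tdig_nonneg (x : ℤ) (i : ZMod n) : 0 ≤ tdig n x i := Int.emod_nonneg _ (by norm_num)

lemma tdig_le (x : ℤ) (i : ZMod n) : tdig n x i ≤ 2 :=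
  Int.le_of_lt_add_one (Int.emod_lt_of_pos _ (by norm_num))

lemma rot_nonneg (hn : 2 ≤ n) (x : ℤ) (i : ZMod n) : 0 ≤ rot n x i :=
  Int.emod_nonneg _ (modulus_pos hn).ne'

lemma rot_lt (hn : 2 ≤ n) (x : ℤ) (i : ZMod n) : rot n x i < 3 ^ n - 1 :=
  Int.emod_lt_of_pos _ (modulus_pos hn)

lemma three_dvd_pow (hn : 2 ≤ n) : (3 : ℤ) ∣ 3 ^ n := dvd_pow_self _ (by omega)

lemma modulus_mul_emod_three (hn : 2 ≤ n) (q : ℤ) : ((3 ^ n - 1) * q) % 3 = (-q) % 3 := by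
  obtain ⟨m, hm⟩ := three_dvd_pow hn
  rw [hm, show (3 * m - 1) * q = -q + 3 * (m * q) by ring, Int.add_mul_emod_self_left]

lemma carry_spec (x y : ℤ) (i : ZMod n) :
    rot n x i + rot n y i = rot n (x + y) i + (3 ^ n - 1) * carry n x y i := by
  have h : rot n x i + rot n y i ≡ rot n (x + y) i [ZMOD 3 ^ n - 1] := by
    have := (Int.mod_modEq (3 ^ (-i).val * x) (3 ^ n - 1)).add
      (Int.mod_modEq (3 ^ (-i).val * y) (3 ^ n - 1))
    refine this.trans ?_
    rw [← mul_add]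
    exact (Int.mod_modEq _ _).symm
  rw [carry, Int.mul_ediv_cancel' h.symm.dvd]
  ring

lemma carry_nonneg (hn : 2 ≤ n) (x y : ℤ) (i : ZMod n) : 0 ≤ carry n x y i := by
  have := carry_spec x y i
  have := rot_lt hn (x + y) i
  have := rot_nonneg hn x i
  have := rot_nonneg hn y i
  have := modulus_pos hn
  by_contra! h
  nlinarith

lemma carry_le (hn : 2 ≤ n) (x y : ℤ) (i : ZMod n) : carry n x y i ≤ 1 := by
  have := carry_spec x y i
  have := rot_nonneg hn (x + y) i
  have := rot_lt hn x i
  have := rot_lt hn y i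
  have := modulus_pos hn
  by_contra! h
  nlinarith

lemma carry_congr {x x' y y' : ℤ} (h : x ≡ x' [ZMOD 3 ^ n - 1]) (h' : y ≡ y' [ZMOD 3 ^ n - 1])
    (i : ZMod n) : carry n x y i = carry n x' y' i := by
  rw [carry, carry, rot_congr h, rot_congr h', rot_congr (h.add h')]

lemma rot_emod (x : ℤ) (i : ZMod n) : rot n (x % (3 ^ n - 1)) i = rot n x i :=
  rot_congr (Int.mod_modEq _ _) i

variable [NeZero n]

lemma rot_eq (x : ℤ) (i : ZMod n) (t : ℕ) (h : (t : ZMod n) = -i) :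
    rot n x i = 3 ^ t * x % (3 ^ n - 1) := by
  refine Int.ModEq.mul_right x (pow_modEq_of_cast_eq ?_)
  rw [h, ZMod.natCast_zmod_val]

lemma rot_pow_mul (x : ℤ) (t : ℕ) (i : ZMod n) : rot n (3 ^ t * x) i = rot n x (i - (t : ZMod n)) := by
  rw [rot_eq x (i - (t : ZMod n)) ((-i).val + t) (by rw [Nat.cast_add, ZMod.natCast_zmod_val]; ring), rot]
  ring_nf

lemma tdig_pow_mul (x : ℤ) (t : ℕ) (i : ZMod n) : tdig n (3 ^ t * x) i = tdig n x (i - (t : ZMod n)) := by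
  rw [tdig, tdig, rot_pow_mul]

/-- Passing to the next rotation extracts one digit. -/
lemma three_mul_rot (hn : 2 ≤ n) (x : ℤ) (i : ZMod n) :
    3 * rot n x i = rot n x (i - 1) + (3 ^ n - 1) * tdig n x (i - 1) := by
  have h1 : rot n x (i - 1) = 3 * rot n x i % (3 ^ n - 1) := by
    rw [rot_eq x (i - 1) ((-i).val + 1) (by push_cast; rw [ZMod.natCast_zmod_val]; ring), rot, pow_succ',
      mul_assoc]
    exact ((Int.mod_modEq _ _).mul_left 3).symm
  have h2 := Int.emod_add_mul_ediv (3 * rot n x i) (3 ^ n - 1)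
  rw [← h1] at h2
  have hM := modulus_pos hn
  have hq0 : 0 ≤ 3 * rot n x i / (3 ^ n - 1) :=
    Int.ediv_nonneg (by linarith [rot_nonneg hn x i]) hM.le
  have hq3 : 3 * rot n x i / (3 ^ n - 1) < 3 :=
    Int.ediv_lt_of_lt_mul hM (by linarith [rot_lt hn x i])
  have hq : tdig n x (i - 1) = 3 * rot n x i / (3 ^ n - 1) := by
    have := modulus_mul_emod_three hn (3 * rot n x i / (3 ^ n - 1))
    rw [tdig]
    omega
  rw [hq, h2]

lemma carry_step (hn : 2 ≤ n) (x y : ℤ) (i : ZMod n) :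
    tdig n x i + tdig n y i + carry n x y i = tdig n (x + y) i + 3 * carry n x y (i + 1) := by
  have e := carry_spec x y i
  have e' := carry_spec x y (i + 1)
  have hx := three_mul_rot hn x (i + 1)
  have hy := three_mul_rot hn y (i + 1)
  have hz := three_mul_rot hn (x + y) (i + 1)
  rw [add_sub_cancel_right] at hx hy hz
  refine mul_left_cancel₀ (modulus_pos hn).ne' ?_
  linear_combination 3 * e' - hx - hy + hz - e

lemma carry_pow_mul (x y : ℤ) (t : ℕ) (i : ZMod n) :
    carry n (3 ^ t * x) (3 ^ t * y) i = carry n x y (i - (t : ZMod n)) := by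
  rw [carry, carry, ← mul_add, rot_pow_mul, rot_pow_mul, rot_pow_mul]

lemma dig_eq_tdig (hn : 2 ≤ n) (x : ℤ) (m : ℕ) : (dig n x m : ℤ) = tdig n x m := by
  have hM := modulus_pos hn
  have hlt : m % n < n := Nat.mod_lt _ (by omega)
  set i := m % n with hi
  set y := x % (3 ^ n - 1) with hy
  have hy0 : 0 ≤ y := Int.emod_nonneg _ hM.ne'
  have hyM : y < 3 ^ n - 1 := Int.emod_lt_of_pos _ hM
  have hsplit : (3 : ℤ) ^ n = 3 ^ (n - i) * 3 ^ i := by rw [← pow_add]; congr 1; omega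
  have hp : (0 : ℤ) < 3 ^ i := by positivity
  have hp' : (0 : ℤ) < 3 ^ (n - i) := by positivity
  have hab := Int.emod_add_mul_ediv y (3 ^ i)
  set a := y / 3 ^ i
  set b := y % 3 ^ i
  have hb0 : 0 ≤ b := Int.emod_nonneg _ hp.ne'
  have hb1 : b + 1 ≤ 3 ^ i := Int.emod_lt_of_pos _ hp
  have ha0 : 0 ≤ a := Int.ediv_nonneg hy0 hp.le
  have ha1 : a + 1 ≤ 3 ^ (n - i) :=
    Int.ediv_lt_of_lt_mul hp (by rw [← hsplit]; linarith)
  have hrot : rot n x m = a + 3 ^ (n - i) * b := by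
    rw [← rot_emod, ← hy, rot_eq y (m : ZMod n) (n - i) ?_]
    · have : 3 ^ (n - i) * y = (a + 3 ^ (n - i) * b) + (3 ^ n - 1) * a := by
        rw [hsplit, ← hab]; ring
      rw [this, Int.add_mul_emod_self_left]
      apply Int.emod_eq_of_lt
      · positivity
      · by_contra! hc
        have hbe : b + 1 = 3 ^ i := by
          by_contra hne
          have : b + 2 ≤ 3 ^ i := by omega
          nlinarith
        have hae : a + 1 = 3 ^ (n - i) := by
          have : 3 ^ (n - i) * (b + 1) = (3 : ℤ) ^ n := by rw [hbe, hsplit]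
          nlinarith
        have : y = 3 ^ n - 1 := by rw [← hab, hsplit, ← hae]; linarith
        linarith
    · rw [Nat.cast_sub hlt.le, hi]; simp
  rw [tdig, hrot]
  obtain ⟨c, hc⟩ : (3 : ℤ) ∣ 3 ^ (n - i) := dvd_pow_self _ (by omega)
  rw [hc, mul_assoc, Int.add_mul_emod_self_left]
  unfold dig
  rw [← hi, ← hy]
  push_cast
  rw [Int.toNat_of_nonneg hy0]

lemma wt_eq_sum (hn : 2 ≤ n) (x : ℤ) : (wt n x : ℤ) = ∑ i : ZMod n, tdig n x i := by
  rw [wt, Nat.cast_sum]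
  simp_rw [dig_eq_tdig hn]
  refine Finset.sum_bij (fun a _ => (a : ZMod n)) (by simp) ?_ ?_ (by simp)
  · intro a ha b hb h
    rw [Finset.mem_range] at ha hb
    have := (ZMod.natCast_eq_natCast_iff' a b n).1 h
    rwa [Nat.mod_eq_of_lt ha, Nat.mod_eq_of_lt hb] at this
  · intro b _
    exact ⟨b.val, Finset.mem_range.2 b.val_lt, ZMod.natCast_zmod_val b⟩

lemma wt_congr (hn : 2 ≤ n) {x y : ℤ} (h : x ≡ y [ZMOD 3 ^ n - 1]) : wt n x = wt n y := by
  have : (wt n x : ℤ) = wt n y := by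
    rw [wt_eq_sum hn, wt_eq_sum hn]
    exact Finset.sum_congr rfl fun i _ => tdig_congr h i
  exact_mod_cast this

lemma wt_pow_mul (hn : 2 ≤ n) (x : ℤ) (t : ℕ) : wt n (3 ^ t * x) = wt n x := by
  have : (wt n (3 ^ t * x) : ℤ) = wt n x := by
    rw [wt_eq_sum hn, wt_eq_sum hn]
    simp_rw [tdig_pow_mul]
    exact Equiv.sum_comp (Equiv.subRight (t : ZMod n)) (tdig n x)
  exact_mod_cast this

/-- Every carry lowers the weight of a sum by two. -/
lemma wt_add_wt (hn : 2 ≤ n) (x y : ℤ) :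
    (wt n x : ℤ) + wt n y = wt n (x + y) + 2 * ∑ i : ZMod n, carry n x y i := by
  have h := Finset.sum_congr rfl fun (i : ZMod n) (_ : i ∈ Finset.univ) => carry_step hn x y i
  simp only [Finset.sum_add_distrib, ← Finset.mul_sum] at h
  have hs : ∑ i : ZMod n, carry n x y (i + 1) = ∑ i : ZMod n, carry n x y i :=
    Equiv.sum_comp (Equiv.addRight (1 : ZMod n)) (carry n x y)
  rw [hs] at h
  rw [wt_eq_sum hn, wt_eq_sum hn, wt_eq_sum hn]
  linarith

lemma eq_of_tdig_eq (hn : 2 ≤ n) {x y : ℤ} (hx0 : 0 ≤ x) (hx : x < 3 ^ n - 1) (hy0 : 0 ≤ y)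
    (hy : y < 3 ^ n - 1) (h : ∀ i : ZMod n, tdig n x i = tdig n y i) : x = y := by
  have key : ∀ t : ℕ, rot n x (-t) - rot n y (-t) = 3 ^ t * (x - y) := by
    intro t
    induction t with
    | zero => simp [rot_zero, Int.emod_eq_of_lt, *]
    | succ t ih =>
      have h1 := three_mul_rot hn x (-t)
      have h2 := three_mul_rot hn y (-t)
      rw [show (-((t + 1 : ℕ) : ZMod n)) = -t - 1 by push_cast; ring, pow_succ]
      rw [h] at h1
      linarith
  have h := key n
  rw [ZMod.natCast_self, neg_zero, rot_zero, rot_zero, Int.emod_eq_of_lt hx0 hx,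
    Int.emod_eq_of_lt hy0 hy] at h
  have := modulus_pos hn
  have h' : (3 ^ n - 1) * (x - y) = 0 := by linarith
  rcases mul_eq_zero.1 h' with h' | h' <;> linarith

lemma exists_tdig_eq (hn : 2 ≤ n) (f : ZMod n → ℕ) (hf : ∀ i, f i ≤ 2) (h2 : ∃ i, f i ≠ 2)
    (h0 : ∃ i, f i ≠ 0) : ∃ x : ℤ, 0 < x ∧ x < 3 ^ n - 1 ∧ ∀ i, tdig n x i = f i := by
  let g : Fin n → Fin 3 := fun i => ⟨f (i : ℕ), Nat.lt_succ_of_le (hf _)⟩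
  set X : Fin (3 ^ n) := finFunctionFinEquiv g with hX
  have hdig : ∀ i : ℕ, i < n → (X : ℕ) / 3 ^ i % 3 = f i := by
    intro i hi
    have : finFunctionFinEquiv.symm X ⟨i, hi⟩ = g ⟨i, hi⟩ := by rw [hX, Equiv.symm_apply_apply]
    exact congrArg Fin.val this
  have hlt : (X : ℕ) + 1 < 3 ^ n := by
    refine lt_of_le_of_ne X.2 fun he => ?_
    obtain ⟨i, hi⟩ := h2
    have h := hdig i.val i.val_lt
    rw [ZMod.natCast_zmod_val] at h
    apply hi
    rw [← h]
    obtain ⟨m, hm⟩ : ∃ m, n = i.val + 1 + m := ⟨n - (i.val + 1), by have := i.val_lt; omega⟩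
    have h3 : (3 : ℕ) ^ n = 3 ^ i.val * (3 * 3 ^ m) := by
      conv_lhs => rw [hm]
      ring
    have hp : 0 < 3 ^ i.val := by positivity
    have hq : 0 < 3 ^ m := by positivity
    have hd : (X : ℕ) / 3 ^ i.val = 3 * 3 ^ m - 1 := by
      rw [Nat.div_eq_iff hp]
      obtain ⟨c, hc⟩ : ∃ c, 3 * 3 ^ m = c + 1 := ⟨3 * 3 ^ m - 1, by omega⟩
      rw [hc, mul_add] at h3
      rw [hc, Nat.add_sub_cancel, mul_comm c]
      omega
    rw [hd]
    omega
  have hcast : ((X : ℕ) : ℤ) + 1 < 3 ^ n := by exact_mod_cast hlt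
  have htd : ∀ i, tdig n (X : ℕ) i = f i := by
    intro i
    have h := hdig i.val i.val_lt
    rw [ZMod.natCast_zmod_val] at h
    rw [← h]
    conv_lhs => rw [← ZMod.natCast_zmod_val i]
    rw [← dig_eq_tdig hn, dig, Int.emod_eq_of_lt (by positivity) (by linarith),
      Int.toNat_natCast, Nat.mod_eq_of_lt i.val_lt]
  refine ⟨(X : ℕ), ?_, by linarith, htd⟩
  rcases Nat.eq_zero_or_pos (X : ℕ) with h | h
  · obtain ⟨i, hi⟩ := h0
    have := htd i
    rw [h] at this
    simp [tdig, rot] at this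
    omega
  · exact_mod_cast h

end

lemma exists_unique_one_of_sum_eq_one {ι : Type*} [Fintype ι] {c : ι → ℤ} (h0 : ∀ i, 0 ≤ c i)
    (h1 : ∑ i, c i = 1) : ∃ p, c p = 1 ∧ ∀ i, i ≠ p → c i = 0 := by
  classical
  obtain ⟨p, hp⟩ : ∃ p, c p ≠ 0 := by
    by_contra! h
    simp [h] at h1
  have hs := Finset.add_sum_erase Finset.univ c (Finset.mem_univ p)
  rw [h1] at hs
  have hn : 0 ≤ ∑ i ∈ Finset.univ.erase p, c i := Finset.sum_nonneg fun i _ => h0 i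
  have hp0 := h0 p
  have hz : ∑ i ∈ Finset.univ.erase p, c i = 0 := by omega
  refine ⟨p, by omega, fun i hi => ?_⟩
  exact (Finset.sum_eq_zero_iff_of_nonneg fun i _ => h0 i).1 hz i
    (Finset.mem_erase.2 ⟨hi, Finset.mem_univ i⟩)

section

variable {n : ℕ}

lemma add_ediv_modulus (hn : 2 ≤ n) (x y : ℤ) :
    (x + y) / (3 ^ n - 1) = x / (3 ^ n - 1) + y / (3 ^ n - 1) + carry n x y 0 := by
  have h := carry_spec x y (0 : ZMod n)
  rw [rot_zero, rot_zero, rot_zero] at h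
  have hx := Int.emod_add_mul_ediv x (3 ^ n - 1)
  have hy := Int.emod_add_mul_ediv y (3 ^ n - 1)
  have hz := Int.emod_add_mul_ediv (x + y) (3 ^ n - 1)
  refine mul_left_cancel₀ (modulus_pos hn).ne' ?_
  linear_combination hz - hx - hy + h

variable [NeZero n]

/-- A property stable under `i ↦ i + 1` holds on all of `ZMod n` once it holds at `0`. -/
lemma zmod_induction {P : ZMod n → Prop} (h0 : P 0) (hs : ∀ i, P i → P (i + 1)) (i : ZMod n) :
    P i := by
  have : ∀ t : ℕ, P t := fun t => by
    induction t with
    | zero => simpa using h0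
    | succ t ih => simpa using hs _ ih
  simpa using this i.val

lemma two_mul_wt_eq_iff (hn : 2 ≤ n) (x : ℤ) :
    2 * wt n x = wt n (x + x) ↔
      (∀ i : ZMod n, Even (tdig n (x + x) i)) ∧ Even ((x + x) / (3 ^ n - 1)) := by
  have hw := wt_add_wt hn x x
  have hq := add_ediv_modulus hn x x
  have hc0 := carry_nonneg hn x x (0 : ZMod n)
  have hc1 := carry_le hn x x (0 : ZMod n)
  constructor
  · intro h
    have hsum : ∑ i : ZMod n, carry n x x i = 0 := by
      have : (2 : ℤ) * wt n x = wt n (x + x) := by exact_mod_cast h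
      linarith
    have hc : ∀ i : ZMod n, carry n x x i = 0 := fun i =>
      (Finset.sum_eq_zero_iff_of_nonneg fun i _ => carry_nonneg hn x x i).1 hsum i
        (Finset.mem_univ i)
    refine ⟨fun i => ⟨tdig n x i, ?_⟩, ⟨x / (3 ^ n - 1), ?_⟩⟩
    · have := carry_step hn x x i
      rw [hc, hc] at this
      linarith
    · rw [hq, hc]; ring
  · rintro ⟨he, hev⟩
    have hc : ∀ i : ZMod n, carry n x x i = 0 := by
      refine zmod_induction ?_ fun i hi => ?_
      · obtain ⟨m, hm⟩ := hev
        omega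
      · have := carry_step hn x x i
        have := carry_nonneg hn x x (i + 1)
        have := carry_le hn x x (i + 1)
        obtain ⟨m, hm⟩ := he i
        omega
    simp only [hc, Finset.sum_const_zero] at hw
    omega

lemma neg_digits (hn : 2 ≤ n) {y : ℤ} (hy : y % (3 ^ n - 1) ≠ 0) :
    (∀ i : ZMod n, tdig n (-y) i = 2 - tdig n y i) ∧
      -y / (3 ^ n - 1) = -(y / (3 ^ n - 1)) - 1 := by
  have hM := modulus_pos hn
  have hr0 : ∀ i : ZMod n, rot n 0 i = 0 := fun i => by simp [rot]
  have hc : ∀ i : ZMod n, carry n y (-y) i = 1 := by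
    refine zmod_induction ?_ fun i hi => ?_
    · have h := carry_spec y (-y) (0 : ZMod n)
      rw [add_neg_cancel, hr0, rot_zero] at h
      have hpos : 0 < y % (3 ^ n - 1) := lt_of_le_of_ne (Int.emod_nonneg _ hM.ne') hy.symm
      have h1 := rot_nonneg hn (-y) (0 : ZMod n)
      have h2 := carry_le hn y (-y) (0 : ZMod n)
      have h3 : carry n y (-y) (0 : ZMod n) ≠ 0 := fun h0 => by
        rw [h0] at h
        linarith
      have h4 := carry_nonneg hn y (-y) (0 : ZMod n)
      omega
    · have := carry_step hn y (-y) i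
      have := carry_le hn y (-y) (i + 1)
      have := tdig_nonneg y i
      have := tdig_nonneg (-y) i
      have h0 : tdig n (y + -y) i = 0 := by rw [add_neg_cancel, tdig, hr0]; rfl
      omega
  constructor
  · intro i
    have := carry_step hn y (-y) i
    have h0 : tdig n (y + -y) i = 0 := by rw [add_neg_cancel, tdig, hr0]; rfl
    rw [hc, hc] at this
    omega
  · have := add_ediv_modulus hn y (-y)
    rw [add_neg_cancel, hc, Int.zero_ediv] at this
    omega

/-- Multiplying by `3 ^ t` has a quotient with the parity of the sum of the top `t` digits. -/
lemma even_pow_mul_ediv_sub (hn : 2 ≤ n) {j : ℤ} (h0 : 0 ≤ j) (hj : j < 3 ^ n - 1) (t : ℕ) :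
    Even (3 ^ t * j / (3 ^ n - 1) - ∑ u ∈ Finset.range t, tdig n j (-(u + 1 : ZMod n))) := by
  induction t with
  | zero => simp [Int.ediv_eq_zero_of_lt h0 hj]
  | succ t ih =>
    have h1 := three_mul_rot hn j (-(t : ZMod n))
    rw [rot_eq j (-(t : ZMod n)) t (by ring),
      rot_eq j (-(t : ZMod n) - 1) (t + 1) (by push_cast; ring)] at h1
    have e1 := Int.emod_add_mul_ediv (3 ^ t * j) (3 ^ n - 1)
    have e2 := Int.emod_add_mul_ediv (3 ^ (t + 1) * j) (3 ^ n - 1)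
    have h : 3 ^ (t + 1) * j / (3 ^ n - 1) =
        3 * (3 ^ t * j / (3 ^ n - 1)) + tdig n j (-(t : ZMod n) - 1) := by
      refine mul_left_cancel₀ (modulus_pos hn).ne' ?_
      linear_combination e2 - 3 * e1 + h1
    rw [h, Finset.sum_range_succ, show -(t + 1 : ZMod n) = -t - 1 by ring]
    obtain ⟨m, hm⟩ := ih
    exact ⟨m + 3 ^ t * j / (3 ^ n - 1), by linear_combination hm⟩

lemma emod_ne_zero_of_sum_carry (hn : 2 ≤ n) {x y : ℤ}
    (h : ∑ i : ZMod n, carry n x y i = 1) : (x + y) % (3 ^ n - 1) ≠ 0 := by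
  intro hz
  obtain ⟨p, hp, hq⟩ := exists_unique_one_of_sum_eq_one (carry_nonneg hn x y) h
  have h1 := carry_step hn x y p
  have : Fact (1 < n) := ⟨by omega⟩
  have h0 : tdig n (x + y) p = 0 := by
    rw [tdig_congr (y := 0) (hz.trans (Int.zero_emod _).symm)]
    simp [tdig, rot]
  rw [hp, hq (p + 1) (by simp), h0] at h1
  have := tdig_nonneg x p
  have := tdig_nonneg y p
  omega

lemma mem_S1_iff (hn : 2 ≤ n) (k : ℕ) (j : ℤ) :
    j ∈ S1 n k ↔ 0 < j ∧ j < 3 ^ n - 1 ∧ ∑ i : ZMod n, carry n j (3 ^ k * j) i = 1 ∧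
      (∀ i : ZMod n, Even (tdig n (j + 3 ^ k * j) i)) ∧
      Odd (carry n j (3 ^ k * j) (0 : ZMod n) +
        ∑ u ∈ Finset.range k, tdig n j (-(u + 1 : ZMod n))) := by
  rw [S1, Set.mem_ofPred_eq]
  refine and_congr_right fun h0 => and_congr_right fun hj => ?_
  have hY : (3 ^ k + 1) * j = j + 3 ^ k * j := by ring
  have hd : -(j * cmD k) + -(j * cmD k) = -(j + 3 ^ k * j) := by
    have h2 : cmD k * 2 = 3 ^ k + 1 :=
      Int.ediv_mul_cancel ((Odd.pow (by decide : Odd (3 : ℤ))).add_odd odd_one).two_dvd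
    linear_combination -j * h2
  rw [hY, ← hd, two_mul_wt_eq_iff hn, hd]
  have hw := wt_add_wt hn j (3 ^ k * j)
  have h1 : wt n j + wt n (3 ^ k * j) = wt n (j + 3 ^ k * j) + 2 ↔
      ∑ i : ZMod n, carry n j (3 ^ k * j) i = 1 := by omega
  rw [h1]
  refine and_congr_right fun hs => ?_
  obtain ⟨hdig, hquo⟩ := neg_digits hn (emod_ne_zero_of_sum_carry hn hs)
  refine and_congr (forall_congr' fun i => ?_) ?_
  · rw [hdig]
    simp [Int.even_sub]
  · have hpar := even_pow_mul_ediv_sub hn h0.le hj k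
    have hadd := add_ediv_modulus hn j (3 ^ k * j)
    rw [Int.ediv_eq_zero_of_lt h0.le hj] at hadd
    rw [hquo, hadd]
    rw [Int.even_iff] at *
    rw [Int.odd_iff]
    omega

end

/-- The digit sums of `j` and `3 ^ k * j` are `3` at position `0`, `1` at position `1`, and even
and at most `2` elsewhere. -/
def IsPattern (n k : ℕ) (j : ℤ) : Prop :=
  tdig n j 0 + tdig n j (0 - k) = 3 ∧ tdig n j 1 + tdig n j (1 - k) = 1 ∧
    ∀ i : ZMod n, i ≠ 0 → i ≠ 1 →
      tdig n j i + tdig n j (i - k) = 0 ∨ tdig n j i + tdig n j (i - k) = 2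

/-- The members of `S1` for which the unique carry enters position `1`. -/
def reps (n k : ℕ) : Set ℤ :=
  {j | 0 < j ∧ j < 3 ^ n - 1 ∧ IsPattern n k j ∧
    Odd (∑ u ∈ Finset.range k, tdig n j (-(u + 1 : ZMod n)))}

section

variable {n : ℕ}

lemma dvd_of_dvd_pow_mul (hn : 2 ≤ n) {t : ℕ} {x : ℤ} (h : (3 : ℤ) ^ n - 1 ∣ 3 ^ t * x) :
    (3 : ℤ) ^ n - 1 ∣ x := by
  have hc : IsCoprime ((3 : ℤ) ^ n - 1) 3 :=
    ⟨-1, 3 ^ (n - 1), by rw [← pow_succ, Nat.sub_add_cancel (by omega)]; ring⟩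
  exact hc.pow_right.dvd_of_dvd_mul_left h

lemma pow_mul_emod_pos (hn : 2 ≤ n) {j : ℤ} (h0 : 0 < j) (hj : j < 3 ^ n - 1) (t : ℕ) :
    0 < 3 ^ t * j % (3 ^ n - 1) := by
  refine lt_of_le_of_ne (Int.emod_nonneg _ (modulus_pos hn).ne') fun h => ?_
  have := Int.le_of_dvd h0 (dvd_of_dvd_pow_mul hn (Int.dvd_of_emod_eq_zero h.symm))
  linarith

variable [NeZero n]

lemma pow_mul_emod_mem_S1 (hn : 2 ≤ n) {k : ℕ} {j : ℤ} (h : j ∈ S1 n k) (t : ℕ) :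
    3 ^ t * j % (3 ^ n - 1) ∈ S1 n k := by
  obtain ⟨h0, hj, h1, h2⟩ := h
  refine ⟨pow_mul_emod_pos hn h0 hj t, Int.emod_lt_of_pos _ (modulus_pos hn), ?_⟩
  have key : ∀ a : ℤ, wt n (a * (3 ^ t * j % (3 ^ n - 1))) = wt n (a * j) := fun a => by
    rw [wt_congr hn ((Int.mod_modEq (3 ^ t * j) (3 ^ n - 1)).mul_left a),
      show a * (3 ^ t * j) = 3 ^ t * (a * j) by ring, wt_pow_mul hn]
  have e1 := key 1
  have e2 := key (-cmD k)
  have e3 := key (-(3 ^ k + 1))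
  rw [one_mul, one_mul] at e1
  rw [show ∀ y, -cmD k * y = -(y * cmD k) from fun y => by ring,
    show ∀ y, -cmD k * y = -(y * cmD k) from fun y => by ring] at e2
  rw [neg_mul, neg_mul] at e3
  rw [e1, e2, e3, key, key]
  exact ⟨h1, h2⟩

lemma carry_pattern_step (hn : 2 ≤ n) (k : ℕ) (j : ℤ) (i : ZMod n) :
    tdig n j i + tdig n j (i - k) + carry n j (3 ^ k * j) i =
      tdig n (j + 3 ^ k * j) i + 3 * carry n j (3 ^ k * j) (i + 1) := by
  rw [← carry_step hn, tdig_pow_mul]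

lemma IsPattern.carry_eq (hn : 2 ≤ n) {k : ℕ} {j : ℤ} (h : IsPattern n k j) :
    carry n j (3 ^ k * j) (1 : ZMod n) = 1 ∧
      ∀ i : ZMod n, i ≠ 1 → carry n j (3 ^ k * j) i = 0 := by
  obtain ⟨hu0, hu1, hu⟩ := h
  have hstep := carry_pattern_step hn k j
  have hc0 := carry_nonneg hn j (3 ^ k * j)
  have hd := fun i : ZMod n => tdig_le (j + 3 ^ k * j) i
  have hd0 := fun i : ZMod n => tdig_nonneg (j + 3 ^ k * j) i
  have hc1 := carry_le hn j (3 ^ k * j)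
  have h1 : carry n j (3 ^ k * j) (1 : ZMod n) = 1 := by
    have := hstep 0
    rw [zero_add] at this
    have := hd 0
    have := hc0 0
    have := hc1 1
    omega
  have hind : ∀ t : ℕ, t + 2 ≤ n → carry n j (3 ^ k * j) ((t : ZMod n) + 2) = 0 := by
    intro t
    induction t with
    | zero =>
      intro _
      have := hstep 1
      rw [one_add_one_eq_two] at this
      have := hd0 1
      have := hc0 2
      rw [Nat.cast_zero, zero_add]
      omega
    | succ t ih =>
      intro ht
      have hne : ∀ m : ℕ, m < 2 → (t : ZMod n) + 2 ≠ m := fun m hm he => by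
        have he' : ((t + 2 : ℕ) : ZMod n) = m := by exact_mod_cast he
        rw [ZMod.natCast_eq_natCast_iff', Nat.mod_eq_of_lt (by omega),
          Nat.mod_eq_of_lt (by omega)] at he'
        omega
      have hs := hstep (t + 2)
      have hut := hu (t + 2) (by simpa using hne 0 (by omega)) (by simpa using hne 1 (by omega))
      rw [ih (by omega)] at hs
      have := hd0 (t + 2)
      have := hc0 (t + 2 + 1)
      rw [Nat.cast_succ, add_right_comm]
      omega
  refine ⟨h1, fun i hi => ?_⟩
  rcases Nat.lt_or_ge i.val 2 with h2 | h2
  · have hi0 : i = 0 := by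
      have hv := ZMod.natCast_zmod_val i
      interval_cases i.val
      · simpa using hv.symm
      · exact absurd (by simpa using hv.symm) hi
    have := hind (n - 2) (by omega)
    rw [hi0]
    rwa [Nat.cast_sub hn, ZMod.natCast_self, Nat.cast_ofNat, zero_sub, neg_add_cancel] at this
  · have := hind (i.val - 2) (by have := i.val_lt; omega)
    rwa [Nat.cast_sub h2, ZMod.natCast_zmod_val, Nat.cast_ofNat, sub_add_cancel] at this

lemma mem_reps_iff (hn : 2 ≤ n) (k : ℕ) (j : ℤ) :
    j ∈ reps n k ↔ j ∈ S1 n k ∧ carry n j (3 ^ k * j) (1 : ZMod n) = 1 := by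
  have : Fact (1 < n) := ⟨by omega⟩
  have hstep := carry_pattern_step hn k j
  have hd := fun i : ZMod n => tdig_le (j + 3 ^ k * j) i
  have hd0 := fun i : ZMod n => tdig_nonneg (j + 3 ^ k * j) i
  rw [mem_S1_iff hn]
  constructor
  · rintro ⟨h0, hj, hp, hodd⟩
    obtain ⟨hc1, hc⟩ := hp.carry_eq hn
    refine ⟨⟨h0, hj, ?_, fun i => ?_, ?_⟩, hc1⟩
    · rw [Finset.sum_eq_single 1 (fun i _ => hc i) (by simp), hc1]
    · obtain ⟨hu0, hu1, hu⟩ := hp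
      have hs := hstep i
      rw [Int.even_iff]
      by_cases hi0 : i = 0
      · rw [hi0, zero_add, hc1, hc 0 (by simp)] at hs
        rw [hi0]
        omega
      by_cases hi1 : i = 1
      · rw [hi1, hc1, hc (1 + 1) (by simp)] at hs
        rw [hi1]
        omega
      · rw [hc i hi1, hc (i + 1) (by simpa using hi0)] at hs
        have := hu i hi0 hi1
        omega
    · rwa [hc 0 (by simp), zero_add]
  · rintro ⟨⟨h0, hj, hsum, heven, hodd⟩, hc1⟩
    have hc : ∀ i : ZMod n, i ≠ 1 → carry n j (3 ^ k * j) i = 0 := by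
      obtain ⟨p, hp, hq⟩ := exists_unique_one_of_sum_eq_one (carry_nonneg hn j (3 ^ k * j)) hsum
      have h1p : 1 = p := by
        by_contra hne
        rw [hq 1 hne] at hc1
        omega
      exact h1p ▸ hq
    have heven' := fun i => Int.even_iff.1 (heven i)
    refine ⟨h0, hj, ⟨?_, ?_, fun i hi0 hi1 => ?_⟩, ?_⟩
    · have hs := hstep 0
      rw [zero_add, hc1, hc 0 (by simp)] at hs
      have := tdig_le j (0 : ZMod n)
      have := tdig_le j (0 - k : ZMod n)
      have := heven' 0
      have := hd0 0
      omega
    · have hs := hstep 1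
      rw [hc1, hc (1 + 1) (by simp)] at hs
      have := tdig_nonneg j (1 : ZMod n)
      have := tdig_nonneg j (1 - k : ZMod n)
      have := heven' 1
      have := hd 1
      omega
    · have hs := hstep i
      rw [hc i hi1, hc (i + 1) (by simpa using hi0)] at hs
      have := heven' i
      have := hd i
      have := hd0 i
      omega
    · rwa [hc 0 (by simp), zero_add] at hodd

lemma S1_eq_iUnion_reps (hn : 2 ≤ n) (k : ℕ) : S1 n k = ⋃ j ∈ reps n k, Ccoset n j := by
  ext m
  simp only [Set.mem_iUnion, exists_prop]
  constructor
  · intro hm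
    obtain ⟨h0, hlt, hsum, -, -⟩ := (mem_S1_iff hn k m).1 hm
    obtain ⟨p, hp, -⟩ := exists_unique_one_of_sum_eq_one (carry_nonneg hn m (3 ^ k * m)) hsum
    refine ⟨3 ^ (1 - p).val * m % (3 ^ n - 1),
      (mem_reps_iff hn k _).2 ⟨pow_mul_emod_mem_S1 hn hm _, ?_⟩, (p - 1).val, ZMod.val_lt _, ?_⟩
    · rw [carry_congr (Int.mod_modEq _ _) ((Int.mod_modEq _ _).mul_left _),
        show (3 : ℤ) ^ k * (3 ^ (1 - p).val * m) = 3 ^ (1 - p).val * (3 ^ k * m) by ring,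
        carry_pow_mul, ZMod.natCast_zmod_val, sub_sub_cancel, hp]
    · rw [← rot_eq _ (-(p - 1)) _ (by simp), rot_emod, rot_pow_mul, ZMod.natCast_zmod_val,
        show -(p - 1) - (1 - p) = 0 by ring, rot_zero, Int.emod_eq_of_lt h0.le hlt]
  · rintro ⟨j, hj, t, -, rfl⟩
    exact pow_mul_emod_mem_S1 hn ((mem_reps_iff hn k j).1 hj).1 t

lemma ncard_S1 (hn : 2 ≤ n) (k : ℕ) : (S1 n k).ncard = n * (reps n k).ncard := by
  have himg : S1 n k =
      (fun p : ℕ × ℤ => 3 ^ p.1 * p.2 % ((3 : ℤ) ^ n - 1)) '' (Set.Iio n ×ˢ reps n k) := by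
    rw [S1_eq_iUnion_reps hn]
    ext m
    simp only [Set.mem_iUnion, exists_prop, Set.mem_image, Set.mem_prod, Set.mem_Iio,
      Prod.exists]
    constructor
    · rintro ⟨j, hj, t, ht, rfl⟩
      exact ⟨t, j, ⟨ht, hj⟩, rfl⟩
    · rintro ⟨t, j, ⟨ht, hj⟩, rfl⟩
      exact ⟨j, hj, t, ht, rfl⟩
  rw [himg, Set.InjOn.ncard_image, Set.ncard_prod]
  · simp [Set.ncard_eq_toFinset_card']
  · rintro ⟨t, j⟩ ⟨ht, hj⟩ ⟨t', j'⟩ ⟨ht', hj'⟩ h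
    have hmod : 3 ^ t * j ≡ 3 ^ t' * j' [ZMOD 3 ^ n - 1] := h
    have hmod' : 3 ^ k * (3 ^ t * j) ≡ 3 ^ k * (3 ^ t' * j') [ZMOD 3 ^ n - 1] := hmod.mul_left _
    have hc := carry_congr hmod hmod' (1 + (t : ZMod n))
    rw [show (3 : ℤ) ^ k * (3 ^ t * j) = 3 ^ t * (3 ^ k * j) by ring,
      show (3 : ℤ) ^ k * (3 ^ t' * j') = 3 ^ t' * (3 ^ k * j') by ring, carry_pow_mul,
      carry_pow_mul, add_sub_cancel_right, ((mem_reps_iff hn k j).1 hj).2] at hc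
    have htt : (t : ZMod n) = t' := by
      by_contra hne
      rw [(hj'.2.2.1.carry_eq hn).2] at hc
      · omega
      · intro he
        exact hne (by linear_combination he)
    rw [ZMod.natCast_eq_natCast_iff', Nat.mod_eq_of_lt ht, Nat.mod_eq_of_lt ht'] at htt
    subst htt
    have hdvd := dvd_of_dvd_pow_mul hn ((mul_sub ((3 : ℤ) ^ t) j' j).symm ▸ hmod.dvd)
    have hjj : j ≡ j' [ZMOD 3 ^ n - 1] := Int.modEq_iff_dvd.2 hdvd
    rw [Int.ModEq, Int.emod_eq_of_lt hj.1.le hj.2.1, Int.emod_eq_of_lt hj'.1.le hj'.2.1] at hjj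
    exact Prod.ext rfl hjj

end

/-- Words of length `L` over `{0, 2}` starting with `2`, ending with `0` and without two adjacent
letters `2`, followed by letters `1` up to length `n`. -/
def IsWord (n L : ℕ) (v : ℕ → ℕ) : Prop :=
  (∀ m, L ≤ m → m < n → v m = 1) ∧ v 0 = 2 ∧ v (L - 1) = 0 ∧ (∀ m < L, v m = 0 ∨ v m = 2) ∧
    ∀ m, m + 1 < L → ¬(v m = 2 ∧ v (m + 1) = 2)

lemma isWord_iff {n L : ℕ} (hL : 0 < L) (v : ℕ → ℕ) :
    IsWord n L v ↔ (∀ m, L ≤ m → m < n → v m = 1) ∧ v 0 = 2 ∧ v 1 = 0 ∧ v (L - 1) = 0 ∧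
      (∀ m, 2 ≤ m → m + 2 ≤ L → v m = 0 ∨ v m = 2) ∧
      ∀ m, 2 ≤ m → m + 3 ≤ L → ¬(v m = 2 ∧ v (m + 1) = 2) := by
  constructor
  · rintro ⟨h1, h2, h3, h4, h5⟩
    refine ⟨h1, h2, ?_, h3, fun m _ hm => h4 m (by omega), fun m _ hm => h5 m (by omega)⟩
    have hL2 : 2 ≤ L := by
      by_contra hlt
      rw [show L - 1 = 0 by omega] at h3
      omega
    have ha := h4 1 (by omega)
    by_cases hL3 : L = 2
    · subst hL3
      exact h3
    · have := h5 0 (by omega)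
      rw [zero_add] at this
      omega
  · rintro ⟨h1, h2, h3, h4, h5, h6⟩
    refine ⟨h1, h2, h4, fun m hm => ?_, fun m hm => ?_⟩
    · rcases Nat.lt_or_ge m 2 with hm2 | hm2
      · interval_cases m <;> omega
      · by_cases hmL : m = L - 1
        · rw [hmL]; exact Or.inl h4
        · exact h5 m hm2 (by omega)
    · rcases Nat.lt_or_ge m 2 with hm2 | hm2
      · interval_cases m
        · rw [zero_add]; omega
        · omega
      · by_cases hmL : m + 1 = L - 1
        · rw [hmL]; omega
        · exact h6 m hm2 (by omega)

lemma parity_switch_iff {n w : ℕ} (hw0 : 0 < w) (hwn : w < n) {b : ℕ → ℕ} (hb : ∀ m, b m ≤ 2) :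
    (b 0 + b (n - 1) = 3 ∧ b w + b (w - 1) = 1 ∧
      ∀ m, 0 < m → m < n → m ≠ w → b m + b (m - 1) = 0 ∨ b m + b (m - 1) = 2) ↔
    IsWord n w b ∨ IsWord n (n - w) fun m => b (n - 1 - m) := by
  constructor
  · rintro ⟨h0, h1, h⟩
    have hsucc : ∀ m, m + 1 < n → m + 1 ≠ w → b (m + 1) + b m = 0 ∨ b (m + 1) + b m = 2 :=
      fun m hm hmw => h (m + 1) (by omega) hm hmw
    have hlow : ∀ m, m < w → b m % 2 = b 0 % 2 := by
      intro m
      induction m with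
      | zero => simp
      | succ m ih =>
        intro hm
        have := ih (by omega)
        have := hsucc m (by omega) (by omega)
        omega
    have hhigh : ∀ t, w + t < n → b (w + t) % 2 = b w % 2 := by
      intro t
      induction t with
      | zero => simp
      | succ t ih =>
        intro ht
        have := ih (by omega)
        have := hsucc (w + t) (by omega) (by omega)
        rw [← add_assoc]
        omega
    have hhigh' : ∀ m, w ≤ m → m < n → b m % 2 = b w % 2 := fun m hm hmn => by
      have := hhigh (m - w) (by omega)
      rwa [Nat.add_sub_cancel' hm] at this
    have hn1 := hhigh' (n - 1) (by omega) (by omega)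
    have hw1 := hlow (w - 1) (by omega)
    have b0 := hb 0
    have bn := hb (n - 1)
    rcases (by omega : b 0 = 2 ∨ b 0 = 1) with h2 | h2
    · left
      refine ⟨fun m hm hmn => ?_, h2, by omega, fun m hm => ?_, fun m hm => ?_⟩
      · have := hhigh' m hm hmn
        have := hb m
        omega
      · have := hlow m hm
        have := hb m
        omega
      · have := hsucc m (by omega) (by omega)
        omega
    · right
      refine ⟨fun m hm hmn => ?_, ?_, ?_, fun m hm => ?_, fun m hm => ?_⟩
      · have := hlow (n - 1 - m) (by omega)
        have := hb (n - 1 - m)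
        beta_reduce
        omega
      · rw [show (fun m => b (n - 1 - m)) 0 = b (n - 1) from rfl]; omega
      · beta_reduce
        rw [show n - 1 - (n - w - 1) = w by omega]; omega
      · have := hhigh' (n - 1 - m) (by omega) (by omega)
        have := hb (n - 1 - m)
        beta_reduce
        omega
      · have := hsucc (n - 1 - (m + 1)) (by omega) (by omega)
        rw [show n - 1 - (m + 1) + 1 = n - 1 - m by omega] at this
        beta_reduce
        omega
  · rintro (⟨h1, h2, h3, h4, h5⟩ | ⟨h1, h2, h3, h4, h5⟩)
    · have := h1 (n - 1) (by omega) (by omega)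
      have := h1 w le_rfl hwn
      refine ⟨by omega, by omega, fun m hm hmn hmw => ?_⟩
      rcases Nat.lt_or_ge m w with hlt | hge
      · have := h4 m hlt
        have := h4 (m - 1) (by omega)
        have := h5 (m - 1) (by omega)
        rw [Nat.sub_add_cancel hm] at this
        omega
      · have := h1 m hge hmn
        have := h1 (m - 1) (by omega) (by omega)
        omega
    · simp only at h1 h2 h3 h4 h5
      rw [show n - 1 - (n - w - 1) = w by omega] at h3
      rw [Nat.sub_zero] at h2
      have h1' : ∀ m, m < w → b m = 1 := fun m hm => by
        have := h1 (n - 1 - m) (by omega) (by omega)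
        rwa [show n - 1 - (n - 1 - m) = m by omega] at this
      have h4' : ∀ m, w ≤ m → m < n → b m = 0 ∨ b m = 2 := fun m hm hmn => by
        have := h4 (n - 1 - m) (by omega)
        rwa [show n - 1 - (n - 1 - m) = m by omega] at this
      have := h1' 0 hw0
      have := h1' (w - 1) (by omega)
      refine ⟨by omega, by omega, fun m hm hmn hmw => ?_⟩
      rcases Nat.lt_or_ge m w with hlt | hge
      · have := h1' m hlt
        have := h1' (m - 1) (by omega)
        omega
      · have := h4' m hge hmn
        have := h4' (m - 1) (by omega) (by omega)
        have := h5 (n - 1 - m) (by omega)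
        rw [show n - 1 - (n - 1 - m) = m by omega,
          show n - 1 - (n - 1 - m + 1) = m - 1 by omega] at this
        omega

/-- The positions of the letter `2` in the words of length `m + 1` counted by `Nat.fib m`. -/
def fibSets : ℕ → Finset (Finset ℕ)
  | 0 => ∅
  | 1 => {{0}}
  | m + 2 => fibSets (m + 1) ∪ (fibSets m).image (insert (m + 1))

lemma mem_fibSets (m : ℕ) (T : Finset ℕ) :
    T ∈ fibSets m ↔ 0 ∈ T ∧ (∀ i ∈ T, i < m) ∧ ∀ i ∈ T, i + 1 ∉ T := by
  induction m using Nat.strong_induction_on generalizing T with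
  | _ m ih =>
    match m with
    | 0 =>
      simp only [fibSets, Finset.notMem_empty, false_iff]
      rintro ⟨h0, h1, -⟩
      exact absurd (h1 0 h0) (by omega)
    | 1 =>
      simp only [fibSets, Finset.mem_singleton]
      constructor
      · rintro rfl
        simp
      · rintro ⟨h0, h1, -⟩
        ext i
        rw [Finset.mem_singleton]
        exact ⟨fun hi => by have := h1 i hi; omega, fun hi => hi ▸ h0⟩
    | m + 2 =>
      simp only [fibSets, Finset.mem_union, Finset.mem_image]
      constructor
      · rintro (h | ⟨U, hU, rfl⟩)
        · obtain ⟨h0, h1, h2⟩ := (ih (m + 1) (by omega) T).1 h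
          exact ⟨h0, fun i hi => (h1 i hi).trans (by omega), h2⟩
        · obtain ⟨h0, h1, h2⟩ := (ih m (by omega) U).1 hU
          refine ⟨Finset.mem_insert_of_mem h0, fun i hi => ?_, fun i hi hi' => ?_⟩
          · rcases Finset.mem_insert.1 hi with rfl | hi
            · omega
            · have := h1 i hi
              omega
          · rcases Finset.mem_insert.1 hi with rfl | hi
            · rcases Finset.mem_insert.1 hi' with h | h
              · omega
              · have := h1 _ h
                omega
            · rcases Finset.mem_insert.1 hi' with h | h
              · have := h1 i hi
                omega
              · exact h2 i hi h
      · rintro ⟨h0, h1, h2⟩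
        by_cases hm : m + 1 ∈ T
        · right
          refine ⟨T.erase (m + 1), (ih m (by omega) _).2 ⟨?_, fun i hi => ?_, fun i hi hi' => ?_⟩,
            Finset.insert_erase hm⟩
          · exact Finset.mem_erase.2 ⟨by omega, h0⟩
          · obtain ⟨hne, hi⟩ := Finset.mem_erase.1 hi
            have := h1 i hi
            have : i ≠ m := fun he => h2 i hi (he ▸ hm)
            omega
          · exact h2 i (Finset.mem_of_mem_erase hi) (Finset.mem_of_mem_erase hi')
        · left
          refine (ih (m + 1) (by omega) T).2 ⟨h0, fun i hi => ?_, h2⟩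
          have := h1 i hi
          have : i ≠ m + 1 := fun he => hm (he ▸ hi)
          omega

lemma card_fibSets (m : ℕ) : (fibSets m).card = Nat.fib m := by
  induction m using Nat.strong_induction_on with
  | _ m ih =>
    match m with
    | 0 => rfl
    | 1 => rfl
    | m + 2 =>
      rw [fibSets, Finset.card_union_of_disjoint, Finset.card_image_of_injOn, ih _ (by omega),
        ih _ (by omega), Nat.fib_add_two, add_comm]
      · intro T hT U hU h
        have hn : ∀ T ∈ fibSets m, m + 1 ∉ T := fun T hT hm => by
          have := ((mem_fibSets m T).1 hT).2.1 _ hm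
          omega
        rw [← Finset.erase_insert (hn T hT), ← Finset.erase_insert (hn U hU)]
        exact congrArg (Finset.erase · (m + 1)) h
      · rw [Finset.disjoint_left]
        intro T hT hT'
        obtain ⟨U, -, rfl⟩ := Finset.mem_image.1 hT'
        have := ((mem_fibSets _ _).1 hT).2.1 (m + 1) (Finset.mem_insert_self _ _)
        omega

lemma dig_le (n : ℕ) (j : ℤ) (i : ℕ) : dig n j i ≤ 2 :=
  Nat.le_of_lt_succ (Nat.mod_lt _ (by norm_num))

lemma dig_mod (n : ℕ) (j : ℤ) (i : ℕ) : dig n j (i % n) = dig n j i := by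
  simp [dig]

section

variable {n k w : ℕ}

lemma natCast_mul_inj (hwk : (w : ZMod n) * k = 1) {a b : ℕ} (ha : a < n) (hb : b < n)
    (h : ((a * k : ℕ) : ZMod n) = (b * k : ℕ)) : a = b := by
  push_cast at h
  have h' : (a : ZMod n) = b := by linear_combination w * h - (a - b : ZMod n) * hwk
  rwa [ZMod.natCast_eq_natCast_iff', Nat.mod_eq_of_lt ha, Nat.mod_eq_of_lt hb] at h'

lemma natCast_sub_step {m : ℕ} (hm : 0 < m) :
    ((m * k : ℕ) : ZMod n) - k = ((m - 1) * k : ℕ) := by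
  rw [Nat.cast_mul, Nat.cast_mul, Nat.cast_sub hm]
  ring

lemma zero_sub_step (hn : 2 ≤ n) : (0 : ZMod n) - k = ((n - 1) * k : ℕ) := by
  rw [Nat.cast_mul, Nat.cast_sub (by omega : 1 ≤ n), ZMod.natCast_self]
  ring

lemma mem_Aset_iff (hwn : w < n) (hwk : (w : ZMod n) * k = 1) {m : ℕ} (hm : m < n) :
    m * k % n ∈ Aset n k w ↔ m < w := by
  simp only [Aset, Finset.mem_image, Finset.mem_range]
  refine ⟨?_, fun h => ⟨m, h, rfl⟩⟩
  rintro ⟨a, ha, h⟩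
  rw [natCast_mul_inj hwk hm (ha.trans hwn) ((ZMod.natCast_eq_natCast_iff' _ _ _).2 h.symm)]
  exact ha

variable [NeZero n]

lemma natCast_val_mul (hwk : (w : ZMod n) * k = 1) (i : ZMod n) :
    (((i * w).val * k : ℕ) : ZMod n) = i := by
  rw [Nat.cast_mul, ZMod.natCast_zmod_val, mul_assoc, hwk, mul_one]

lemma isPattern_iff (hn : 2 ≤ n) (hw0 : 0 < w) (hwn : w < n) (hwk : (w : ZMod n) * k = 1)
    (j : ℤ) : IsPattern n k j ↔
      IsWord n w (fun m => dig n j (m * k)) ∨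
        IsWord n (n - w) fun m => dig n j ((n - 1 - m) * k) := by
  rw [← parity_switch_iff (b := fun m => dig n j (m * k)) hw0 hwn fun m => dig_le _ _ _]
  have h0 : (0 : ZMod n) = ((0 * k : ℕ) : ZMod n) := by simp
  have h1 : (1 : ZMod n) = ((w * k : ℕ) : ZMod n) := by rw [Nat.cast_mul, hwk]
  refine and_congr ?_ (and_congr ?_ ?_)
  · rw [zero_sub_step hn, ← dig_eq_tdig hn, h0, ← dig_eq_tdig hn]
    norm_cast
  · rw [h1, natCast_sub_step hw0, ← dig_eq_tdig hn, ← dig_eq_tdig hn]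
    norm_cast
  · constructor
    · intro h m hm hmn hmw
      have := h (m * k : ℕ)
        (fun he => hm.ne' (natCast_mul_inj hwk hmn (by omega) (he.trans h0)))
        (fun he => hmw (natCast_mul_inj hwk hmn hwn (he.trans h1)))
      rw [natCast_sub_step hm, ← dig_eq_tdig hn, ← dig_eq_tdig hn] at this
      exact_mod_cast this
    · intro h i hi0 hi1
      have hi := natCast_val_mul hwk i
      have hpos : 0 < (i * w).val := by
        rcases Nat.eq_zero_or_pos (i * w).val with hz | hz
        · rw [hz] at hi
          exact absurd (h0.trans hi).symm hi0
        · exact hz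
      have := h (i * w).val hpos (ZMod.val_lt _) fun he => hi1 (by rw [← hi, he, h1])
      rw [← hi, natCast_sub_step hpos, ← dig_eq_tdig hn, ← dig_eq_tdig hn]
      exact_mod_cast this

lemma sum_top_digits (hn : 2 ≤ n) (hkn : k < n) (j : ℤ) :
    ∑ u ∈ Finset.range k, tdig n j (-(u + 1 : ZMod n)) =
      ∑ i ∈ Finset.Ico (n - k) n, (dig n j i : ℤ) := by
  rw [Finset.sum_Ico_eq_sum_range, ← Finset.sum_range_reflect, Nat.sub_sub_self hkn.le]
  refine Finset.sum_congr rfl fun u hu => ?_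
  have hu := Finset.mem_range.1 hu
  rw [dig_eq_tdig hn]
  congr 1
  rw [show n - k + u = n - (k - 1 - u + 1) by omega,
    Nat.cast_sub (by omega : k - 1 - u + 1 ≤ n), ZMod.natCast_self]
  push_cast
  ring

/-- The parity of the top `k` digits in terms of a set of positions with odd digits. -/
lemma odd_sum_top_digits_iff (hn : 2 ≤ n) (hkn : k < n) (j : ℤ) (B : Finset ℕ)
    (hB : ∀ i < n, dig n j i % 2 = if i ∈ B then 1 else 0) :
    Odd (∑ u ∈ Finset.range k, tdig n j (-(u + 1 : ZMod n))) ↔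
      Odd (B ∩ Finset.Ico (n - k) n).card := by
  rw [sum_top_digits hn hkn, ← Nat.cast_sum, Int.odd_coe_nat, Nat.odd_iff, Nat.odd_iff,
    Finset.sum_nat_mod, Finset.sum_congr rfl fun i hi => hB i (Finset.mem_Ico.1 hi).2,
    Finset.sum_boole, Finset.filter_mem_eq_inter, Finset.inter_comm, Nat.cast_id]

lemma dig_eq_of_forall (hwk : (w : ZMod n) * k = 1) {P : ℕ → ℕ → Prop} (j : ℤ)
    (h : ∀ m < n, P (m * k % n) (dig n j (m * k))) (i : ℕ) (hi : i < n) : P i (dig n j i) := by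
  have hc := natCast_val_mul hwk (i : ZMod n)
  rw [ZMod.natCast_eq_natCast_iff', Nat.mod_eq_of_lt hi] at hc
  have := h _ (ZMod.val_lt ((i : ZMod n) * (w : ZMod n)))
  rwa [← dig_mod, hc] at this

lemma odd_sum_iff_of_word (hn : 2 ≤ n) (hkodd : Odd k) (hkn : k < n)
    (hwn : w < n) (hwk : (w : ZMod n) * k = 1) {j : ℤ}
    (h : IsWord n w (fun m => dig n j (m * k))) :
    Odd (∑ u ∈ Finset.range k, tdig n j (-(u + 1 : ZMod n))) ↔
      Even (Aset n k w ∩ Finset.Ico (n - k) n).card := by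
  rw [odd_sum_top_digits_iff hn hkn j (Finset.range n \ Aset n k w)]
  · have hB : (Finset.range n \ Aset n k w) ∩ Finset.Ico (n - k) n =
        Finset.Ico (n - k) n \ Aset n k w := by
      ext i
      simp only [Finset.mem_inter, Finset.mem_sdiff, Finset.mem_range, Finset.mem_Ico]
      tauto
    have hcard := Finset.card_sdiff_add_card_inter (Finset.Ico (n - k) n) (Aset n k w)
    rw [Nat.card_Ico, Nat.sub_sub_self hkn.le] at hcard
    rw [hB, Finset.inter_comm (Aset n k w), Nat.odd_iff, Nat.even_iff]
    rw [Nat.odd_iff] at hkodd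
    omega
  · refine dig_eq_of_forall
      (P := fun i x => x % 2 = if i ∈ Finset.range n \ Aset n k w then 1 else 0) hwk j
      fun m hm => ?_
    have hmn : m * k % n < n := Nat.mod_lt _ (by omega)
    simp only [Finset.mem_sdiff, Finset.mem_range, hmn, true_and, mem_Aset_iff hwn hwk hm]
    have h1 := h.1 m
    have h2 := h.2.2.2.1 m
    simp only at h1 h2
    split_ifs with hmw
    · have := h2 hmw
      omega
    · rw [h1 (by omega) hm]

lemma odd_sum_iff_of_rev_word (hn : 2 ≤ n) (hkn : k < n) (hwn : w < n)
    (hwk : (w : ZMod n) * k = 1) {j : ℤ}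
    (h : IsWord n (n - w) fun m => dig n j ((n - 1 - m) * k)) :
    Odd (∑ u ∈ Finset.range k, tdig n j (-(u + 1 : ZMod n))) ↔
      Odd (Aset n k w ∩ Finset.Ico (n - k) n).card := by
  refine odd_sum_top_digits_iff hn hkn j _
    (dig_eq_of_forall (P := fun i x => x % 2 = if i ∈ Aset n k w then 1 else 0) hwk j
      fun m hm => ?_)
  simp only [mem_Aset_iff hwn hwk hm]
  have h1 := h.1 (n - 1 - m)
  have h2 := h.2.2.2.1 (n - 1 - m)
  simp only [show n - 1 - (n - 1 - m) = m by omega] at h1 h2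
  split_ifs with hmw
  · rw [h1 (by omega) (by omega)]
  · have := h2 (by omega)
    omega

/-- The words placed along a permutation `π` of the multiples of `k` are counted by `Nat.fib`. -/
lemma ncard_word (hn : 2 ≤ n) (hwk : (w : ZMod n) * k = 1) {L : ℕ} (hL0 : 0 < L) (hLn : L < n)
    {p : ℕ → ℕ} (hp : ∀ m < n, p m < n) (hpp : ∀ m < n, p (p m) = m) :
    {j : ℤ | 0 < j ∧ j < 3 ^ n - 1 ∧ IsWord n L fun m => dig n j (p m * k)}.ncard =
      Nat.fib (L - 1) := by
  rw [← card_fibSets, ← Set.ncard_coe_finset]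
  refine Set.ncard_congr
    (fun j _ => (Finset.range L).filter fun m => dig n j (p m * k) = 2) ?_ ?_ ?_
  · rintro j ⟨-, -, -, h0, h1, -, h2⟩
    rw [Finset.mem_coe, mem_fibSets]
    refine ⟨by simpa using ⟨hL0, h0⟩, fun i hi => ?_, fun i hi hi' => ?_⟩
    · rw [Finset.mem_filter, Finset.mem_range] at hi
      have : i ≠ L - 1 := fun he => by
        have := hi.2
        rw [he] at this
        simp only at h1
        omega
      omega
    · rw [Finset.mem_filter, Finset.mem_range] at hi hi'
      exact h2 i hi'.1 ⟨hi.2, hi'.2⟩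
  · rintro j j' ⟨h0, hlt, hj⟩ ⟨h0', hlt', hj'⟩ h
    have hv : ∀ m < n, dig n j (p m * k) = dig n j' (p m * k) := by
      intro m hm
      rcases Nat.lt_or_ge m L with hmL | hmL
      · have he := Finset.ext_iff.1 h m
        simp only [Finset.mem_filter, Finset.mem_range, hmL, true_and] at he
        have h1 := hj.2.2.2.1 m hmL
        have h2 := hj'.2.2.2.1 m hmL
        simp only at h1 h2
        omega
      · exact (hj.1 m hmL hm).trans (hj'.1 m hmL hm).symm
    refine eq_of_tdig_eq hn h0.le hlt h0'.le hlt' fun i => ?_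
    have := hv _ (hp _ (ZMod.val_lt (i * (w : ZMod n))))
    rw [hpp _ (ZMod.val_lt _)] at this
    rw [← natCast_val_mul hwk i, ← dig_eq_tdig hn, ← dig_eq_tdig hn, this]
  · intro T hT
    rw [Finset.mem_coe, mem_fibSets] at hT
    obtain ⟨hT0, hT1, hT2⟩ := hT
    set v : ℕ → ℕ := fun m => if L ≤ m then 1 else if m ∈ T then 2 else 0 with hv
    have hval : ∀ m < n, ((((p m * k : ℕ) : ZMod n)) * (w : ZMod n)).val = p m := fun m hm => by
      rw [Nat.cast_mul, mul_assoc, mul_comm (k : ZMod n), hwk, mul_one,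
        ZMod.val_natCast_of_lt (hp m hm)]
    obtain ⟨j, h0, hlt, hj⟩ := exists_tdig_eq hn (fun i : ZMod n => v (p (i * (w : ZMod n)).val))
      (fun i => by simp only [hv]; split_ifs <;> omega)
      ⟨(p L * k : ℕ), by simp only [hval L hLn, hpp L hLn]; simp [hv]⟩
      ⟨(p L * k : ℕ), by simp only [hval L hLn, hpp L hLn]; simp [hv]⟩
    have hd : ∀ m < n, dig n j (p m * k) = v m := fun m hm => by
      have := hj (p m * k : ℕ)
      rw [hval m hm, hpp m hm, ← dig_eq_tdig hn] at this
      exact_mod_cast this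
    refine ⟨j, ⟨h0, hlt, fun m hmL hm => ?_, ?_, ?_, fun m hm => ?_, fun m hm => ?_⟩, ?_⟩
    · simp [hd m hm, hv, hmL]
    · simp [hd 0 (by omega), hv, hL0.ne', hT0]
    · have : L - 1 ∉ T := fun h => by
        have := hT1 _ h
        omega
      simp [hd (L - 1) (by omega), hv, this, show ¬ L ≤ L - 1 by omega]
    · simp only [hd m (by omega), hv]
      split_ifs <;> omega
    · have := hT2 m
      simp only [hd m (by omega), hd (m + 1) (by omega), hv, if_neg (show ¬ L ≤ m by omega),
        if_neg (show ¬ L ≤ m + 1 by omega)]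
      split_ifs <;> simp_all
    · ext m
      rw [Finset.mem_filter, Finset.mem_range]
      constructor
      · rintro ⟨hm, h⟩
        by_contra hmT
        simp [hd m (by omega), hv, hmT, show ¬ L ≤ m by omega] at h
      · intro hm
        have := hT1 m hm
        refine ⟨by omega, ?_⟩
        simp [hd m (by omega), hv, hm, show ¬ L ≤ m by omega]

end

lemma V0set_eq {n k w : ℕ} (hw0 : 0 < w) (hwn : w < n) :
    V0set n k w = {j | 0 < j ∧ j < 3 ^ n - 1 ∧ IsWord n w fun m => dig n j (m * k)} := by
  ext j
  simp only [V0set, Set.mem_ofPred_eq, isWord_iff hw0]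
  refine and_congr_right fun _ => and_congr_right fun _ => ?_
  rw [zero_mul, one_mul]
  refine and_congr ⟨fun h m hm hmn => h m hm (by omega), fun h m hm hmn => h m hm (by omega)⟩
    (and_congr_right fun h0 => and_congr_right fun h1 => and_congr_right fun h2 => ?_)
  have hw : 2 ≤ w := by
    by_contra hlt
    rw [show w = 1 by omega, Nat.sub_self, zero_mul] at h2
    omega
  refine and_congr ⟨fun h m hm hmn => h m hm (by omega), fun h m hm hmn => h m hm (by omega)⟩
    ⟨fun h m hm hmn => h m hm (by omega), fun h m hm hmn => h m hm (by omega)⟩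

lemma V1set_eq {n k w : ℕ} (hw0 : 0 < w) (hwn : w < n) :
    V1set n k w =
      {j | 0 < j ∧ j < 3 ^ n - 1 ∧ IsWord n (n - w) fun m => dig n j ((n - 1 - m) * k)} := by
  ext j
  simp only [V1set, Set.mem_ofPred_eq, isWord_iff (Nat.sub_pos_of_lt hwn)]
  refine and_congr_right fun _ => and_congr_right fun _ => ?_
  rw [show n - 1 - (n - w - 1) = w by omega, Nat.sub_zero, show n - 1 - 1 = n - 2 by omega]
  have hrev : ∀ m, m < n → n - 1 - (n - 1 - m) = m := fun m hm => by omega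
  constructor
  · rintro ⟨h1, h2, h3, h4, h5, h6⟩
    refine ⟨fun m hm hmn => h1 _ (by omega), h5, h3, h2, fun m hm hmn => ?_, fun m hm hmn => ?_⟩
    · exact h4 _ (by omega) (by omega)
    · have := h6 (n - 1 - (m + 1)) (by omega) (by omega)
      rwa [show n - 1 - (m + 1) + 1 = n - 1 - m by omega, and_comm] at this
  · rintro ⟨h1, h2, h3, h4, h5, h6⟩
    refine ⟨fun m hm => ?_, h4, h3, fun m hm hmn => ?_, h2, fun m hm hmn => ?_⟩
    · have := h1 (n - 1 - m) (by omega) (by omega)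
      rwa [hrev m (by omega)] at this
    · have := h5 (n - 1 - m) (by omega) (by omega)
      rwa [hrev m (by omega)] at this
    · have := h6 (n - 1 - (m + 1)) (by omega) (by omega)
      rwa [show n - 1 - (m + 1) + 1 = n - 1 - m by omega, hrev m (by omega),
        hrev (m + 1) (by omega), and_comm] at this

theorem stmt12 (n k : ℕ) (hn : 2 ≤ n) (hkodd : Odd k) (hk0 : 0 < k) (hkn : k < n)
    (hgcd : Nat.gcd n k = 1) (w : ℕ) (hw0 : 0 < w) (hwn : w < n) (hwk : w * k ≡ 1 [MOD n]) :
    (Even ((Aset n k w ∩ Finset.Ico (n - k) n).card) →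
      (S1 n k = ⋃ j ∈ V0set n k w, Ccoset n j) ∧
      (S1 n k).ncard = n * Nat.fib (w - 1) ∧
      ((S1 n k).ncard : ℝ) =
        n * ((((1 + Real.sqrt 5) / 2) ^ (w - 1) - ((1 - Real.sqrt 5) / 2) ^ (w - 1)) /
          Real.sqrt 5)) ∧
    (¬ Even ((Aset n k w ∩ Finset.Ico (n - k) n).card) →
      (S1 n k = ⋃ j ∈ V1set n k w, Ccoset n j) ∧
      (S1 n k).ncard = n * Nat.fib (n - w - 1) ∧
      ((S1 n k).ncard : ℝ) =
        n * ((((1 + Real.sqrt 5) / 2) ^ (n - w - 1) - ((1 - Real.sqrt 5) / 2) ^ (n - w - 1)) /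
          Real.sqrt 5)) := by
  have : NeZero n := ⟨by omega⟩
  have hwk' : (w : ZMod n) * k = 1 := by
    have := (ZMod.natCast_eq_natCast_iff _ _ _).2 hwk
    simpa using this
  have hbinet : ∀ m : ℕ, ((((1 + Real.sqrt 5) / 2) ^ m - ((1 - Real.sqrt 5) / 2) ^ m) /
      Real.sqrt 5) = Nat.fib m := fun m => (Real.coe_fib_eq m).symm
  have hreps : ∀ j, j ∈ reps n k ↔
      (j ∈ V0set n k w ∧ Even (Aset n k w ∩ Finset.Ico (n - k) n).card) ∨
        (j ∈ V1set n k w ∧ Odd (Aset n k w ∩ Finset.Ico (n - k) n).card) := by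
    intro j
    rw [V0set_eq hw0 hwn, V1set_eq hw0 hwn]
    simp only [reps, Set.mem_ofPred_eq, isPattern_iff hn hw0 hwn hwk']
    constructor
    · rintro ⟨h0, hj, h | h, hodd⟩
      · exact Or.inl ⟨⟨h0, hj, h⟩, (odd_sum_iff_of_word hn hkodd hkn hwn hwk' h).1 hodd⟩
      · exact Or.inr ⟨⟨h0, hj, h⟩, (odd_sum_iff_of_rev_word hn hkn hwn hwk' h).1 hodd⟩
    · rintro (⟨⟨h0, hj, h⟩, hpar⟩ | ⟨⟨h0, hj, h⟩, hpar⟩)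
      · exact ⟨h0, hj, Or.inl h, (odd_sum_iff_of_word hn hkodd hkn hwn hwk' h).2 hpar⟩
      · exact ⟨h0, hj, Or.inr h, (odd_sum_iff_of_rev_word hn hkn hwn hwk' h).2 hpar⟩
  have hS := S1_eq_iUnion_reps hn k
  have hcard := ncard_S1 hn k
  rw [hbinet, hbinet]
  constructor
  · intro hpar
    have hV : reps n k = V0set n k w := by
      ext j
      simp [hreps, hpar, ← Nat.not_even_iff_odd]
    have hfib : (V0set n k w).ncard = Nat.fib (w - 1) := by
      rw [V0set_eq hw0 hwn]
      exact ncard_word hn hwk' (p := id) hw0 hwn (fun _ h => h) fun _ _ => rfl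
    rw [hV] at hS hcard
    rw [hfib] at hcard
    exact ⟨hS, hcard, by rw [hcard, Nat.cast_mul]⟩
  · intro hpar
    have hV : reps n k = V1set n k w := by
      ext j
      simp [hreps, hpar, ← Nat.not_even_iff_odd]
    have hfib : (V1set n k w).ncard = Nat.fib (n - w - 1) := by
      rw [V1set_eq hw0 hwn]
      exact ncard_word hn hwk' (p := fun m => n - 1 - m) (by omega) (by omega)
        (fun m hm => by omega) fun m hm => by omega
    rw [hV] at hS hcard
    rw [hfib] at hcard
    exact ⟨hS, hcard, by rw [hcard, Nat.cast_mul]⟩
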